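/- Let n be a nonnegative integer and let a, b, c ∈ ℂ satisfy c + j ≠ 0 and 1−b+j ≠ 0 for 0 ≤ j ≤ n−1, 1−c−n+j ≠ 0 for 0 ≤ j ≤ ⌊n/2⌋, and c−a+n+j ≠ 0 for 0 ≤ j ≤ ⌊n/2⌋. Then ((c−a)_n (a−b)_n)/((c)_n (1−b)_n) = Σ_{k=0}^{⌊n/2⌋} C(n,2k) (c−a+3k) (1−a)_{2k} (a−b−c+1)_k (b+c−a)_k (c−a)_k / ((1−c−n)_k (c−a+n)_{k+1} (1−b)_{2k} (c)_k) + Σ_{0 ≤ 2k+1 ≤ n} C(n,2k+1) (c+k) (1−a)_{2k+1} (a−b−c+1)_k (b+c−a)_{k+1} (c−a)_{k+1} / ((1−c−n)_{k+1} (c−a+n)_{k+1} (1−b)_{2k+1} (c)_{k+1}). (Second-type reciprocal relation dual to the Pfaff–Saalschütz summation theorem, second form.) -/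

import Mathlib

/-- Rising factorial (Pochhammer symbol) of a complex number:
`poch x 0 = 1` and `poch x (m+1) = poch x m * (x + m)`. -/
noncomputable def poch (x : ℂ) : ℕ → ℂ
  | 0 => 1
  | m + 1 => poch x m * (x + (m : ℂ))

lemma poch_zero (x : ℂ) : poch x 0 = 1 := rfl

lemma poch_succ (x : ℂ) (m : ℕ) : poch x (m + 1) = poch x m * (x + (m : ℂ)) := rfl

lemma poch_succ_left (x : ℂ) (m : ℕ) : poch x (m + 1) = x * poch (x + 1) m := by
  induction m with
  | zero => simp [poch]
  | succ m ih =>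
    rw [poch_succ, ih, poch_succ (x + 1)]
    push_cast
    ring

lemma poch_ne_zero (x : ℂ) (m : ℕ) (h : ∀ j : ℕ, j < m → x + (j : ℂ) ≠ 0) : poch x m ≠ 0 := by
  induction m with
  | zero => simp [poch]
  | succ m ih =>
    rw [poch_succ]
    exact mul_ne_zero (ih fun j hj => h j (by omega)) (h m (by omega))

lemma continuous_poch (m : ℕ) : Continuous fun x => poch x m := by
  induction m with
  | zero => simpa [poch] using continuous_const
  | succ m ih =>
    simp only [poch_succ]
    fun_prop

lemma choose_cast_succ (n k : ℕ) :
    (n.choose (k + 1) : ℂ) = n.choose k * ((n : ℂ) - k) / ((k : ℂ) + 1) := by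
  have hk : ((k : ℂ) + 1) ≠ 0 := by exact_mod_cast Nat.succ_ne_zero k
  rw [eq_div_iff hk]
  rcases le_or_gt k n with h | h
  · have := Nat.choose_succ_right_eq n k
    rw [← Nat.cast_sub h]
    exact_mod_cast this
  · rw [Nat.choose_eq_zero_of_lt h, Nat.choose_eq_zero_of_lt (by omega)]
    simp

lemma choose_cast_succ_succ (n k : ℕ) :
    ((n + 1).choose (k + 1) : ℂ) = n.choose k * ((n : ℂ) + 1) / ((k : ℂ) + 1) := by
  have hk : ((k : ℂ) + 1) ≠ 0 := by exact_mod_cast Nat.succ_ne_zero k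
  rw [eq_div_iff hk]
  have := Nat.add_one_mul_choose_eq n k
  rw [mul_comm (n.choose k : ℂ)]
  exact_mod_cast this.symm

/-- even terms -/
noncomputable def tA (a b c : ℂ) (n k : ℕ) : ℂ :=
  (n.choose (2 * k) : ℂ) *
          ((c - a + 3 * (k : ℂ)) * poch (1 - a) (2 * k) * poch (a - b - c + 1) k *
            poch (b + c - a) k * poch (c - a) k) /
          (poch (1 - c - (n : ℂ)) k * poch (c - a + (n : ℂ)) (k + 1) *
            poch (1 - b) (2 * k) * poch c k)

/-- odd terms -/
noncomputable def tB (a b c : ℂ) (n k : ℕ) : ℂ :=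
  (n.choose (2 * k + 1) : ℂ) *
          ((c + (k : ℂ)) * poch (1 - a) (2 * k + 1) * poch (a - b - c + 1) k *
            poch (b + c - a) (k + 1) * poch (c - a) (k + 1)) /
          (poch (1 - c - (n : ℂ)) (k + 1) * poch (c - a + (n : ℂ)) (k + 1) *
            poch (1 - b) (2 * k + 1) * poch c (k + 1))

/-- partial sums ending at an even term -/
noncomputable def gE (a b c : ℂ) (n k : ℕ) : ℂ :=
  (n.choose (2 * k) : ℂ) *
          (poch (1 - a) (2 * k + 1) * poch (a - b - c + 1) k *
            poch (b + c - a) (k + 1) * poch (c - a) (k + 1)) /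
          (poch (1 - c - (n : ℂ)) k * poch (c - a + (n : ℂ) + 1) (k + 1) *
            poch (1 - b) (2 * k) * poch c k)

/-- partial sums ending at an odd term -/
noncomputable def gO (a b c : ℂ) (n k : ℕ) : ℂ :=
  -((n.choose (2 * k + 1) : ℂ) *
          (poch (1 - a) (2 * k + 2) * poch (a - b - c + 1) (k + 1) *
            poch (b + c - a) (k + 1) * poch (c - a) (k + 1)) /
          (poch (1 - c - (n : ℂ)) (k + 1) * poch (c - a + (n : ℂ) + 1) (k + 1) *
            poch (1 - b) (2 * k + 1) * poch c k))

/-- weighted difference in `n` -/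
noncomputable def hD (a b c : ℂ) (t : ℕ → ℕ → ℂ) (n k : ℕ) : ℂ :=
  (c + n) * (1 - b + n) * t (n + 1) k - (c - a + n) * (a - b + n) * t n k

/-- all shifts by integers are nonzero -/
def NonInt (x : ℂ) : Prop := ∀ m : ℤ, x + m ≠ 0

lemma NonInt.poch_ne {x : ℂ} (h : NonInt x) (m : ℤ) (k : ℕ) : poch (x + m) k ≠ 0 := by
  apply poch_ne_zero
  intro j _ h0
  apply h (m + j)
  push_cast
  rw [← h0]; ring

lemma NonInt.neg {x : ℂ} (h : NonInt x) : NonInt (-x) := by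
  intro m h0
  apply h (-m)
  push_cast
  linear_combination -h0

lemma odd_step (a b c : ℂ) (hb : NonInt b) (hc : NonInt c) (hca : NonInt (c - a)) (n k : ℕ) :
    gE a b c n k + hD a b c (tB a b c) n k = gO a b c n k := by
  have e1 : poch (1 - c - ((n + 1 : ℕ) : ℂ)) (k + 1) = (-c - n) * poch (1 - c - n) k := by
    rw [poch_succ_left]; push_cast
    congr 1
    · ring
    · congr 1; ring
  have e2 : poch (c - a + ((n + 1 : ℕ) : ℂ)) (k + 1)
      = poch (c - a + n + 1) k * (c - a + n + 1 + k) := by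
    rw [poch_succ]; push_cast
    congr 1
    · congr 1; ring
    · ring
  have n1 : -c - (n : ℂ) ≠ 0 := by
    have := hc.neg (-n); push_cast at this; convert this using 1; ring
  have n2 : 1 - c - (n : ℂ) + k ≠ 0 := by
    have := hc.neg (1 - n + k); push_cast at this; convert this using 1; ring
  have n3 : c - a + (n : ℂ) ≠ 0 := by
    have := hca n; push_cast at this; convert this using 1
  have n4 : c - a + (n : ℂ) + 1 + k ≠ 0 := by
    have := hca (n + 1 + k); push_cast at this; convert this using 1; ring
  have n5 : c + (k : ℂ) ≠ 0 := by
    have := hc k; push_cast at this; convert this using 1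
  have n6 : 1 - b + (2 * k : ℂ) ≠ 0 := by
    have := hb.neg (1 + 2 * k); push_cast at this; convert this using 1; ring
  have n7 : (2 * k : ℂ) + 1 ≠ 0 := by exact_mod_cast Nat.succ_ne_zero (2 * k)
  have p1 : poch (1 - c - n) k ≠ 0 := by
    have := hc.neg.poch_ne (1 - n) k; push_cast at this; convert this using 2; ring
  have p2 : poch (c - a + n + 1) k ≠ 0 := by
    have := hca.poch_ne (n + 1) k; push_cast at this; convert this using 2; ring
  have p3 : poch (1 - b) (2 * k) ≠ 0 := by
    have := hb.neg.poch_ne 1 (2 * k); push_cast at this; convert this using 2; ring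
  have p4 : poch c k ≠ 0 := by
    have := hc.poch_ne 0 k; push_cast at this; convert this using 2; ring
  unfold gE hD tB gO
  rw [e1, e2, poch_succ_left (c - a + n) k, choose_cast_succ_succ, choose_cast_succ,
    poch_succ (1 - a) (2 * k + 1)]
  simp only [poch_succ (1 - a) (2 * k), poch_succ (1 - b) (2 * k), poch_succ _ k]
  push_cast
  field_simp
  ring

lemma even_step (a b c : ℂ) (hb : NonInt b) (hc : NonInt c) (hca : NonInt (c - a)) (n k : ℕ) :
    gO a b c n k + hD a b c (tA a b c) n (k + 1) = gE a b c n (k + 1) := by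
  have e1 : poch (1 - c - ((n + 1 : ℕ) : ℂ)) (k + 1) = (-c - n) * poch (1 - c - n) k := by
    rw [poch_succ_left]; push_cast
    congr 1
    · ring
    · congr 1; ring
  have e2 : poch (c - a + ((n + 1 : ℕ) : ℂ)) (k + 1 + 1)
      = poch (c - a + n + 1) (k + 1 + 1) := by
    push_cast
    congr 1; ring
  have n1 : -c - (n : ℂ) ≠ 0 := by
    have := hc.neg (-n); push_cast at this; convert this using 1; ring
  have n2 : 1 - c - (n : ℂ) + k ≠ 0 := by
    have := hc.neg (1 - n + k); push_cast at this; convert this using 1; ring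
  have n3 : c - a + (n : ℂ) ≠ 0 := by
    have := hca n; push_cast at this; convert this using 1
  have n4 : c - a + (n : ℂ) + 1 + k ≠ 0 := by
    have := hca (n + 1 + k); push_cast at this; convert this using 1; ring
  have n4' : c - a + (n : ℂ) + 1 + (k + 1) ≠ 0 := by
    have := hca (n + 1 + (k + 1)); push_cast at this; convert this using 1; ring
  have n5 : c + (k : ℂ) ≠ 0 := by
    have := hc k; push_cast at this; convert this using 1
  have n6 : 1 - b + (2 * k : ℂ) ≠ 0 := by
    have := hb.neg (1 + 2 * k); push_cast at this; convert this using 1; ring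
  have n6' : 1 - b + (2 * k + 1 : ℂ) ≠ 0 := by
    have := hb.neg (1 + (2 * k + 1)); push_cast at this; convert this using 1; ring
  have n7 : (2 * k + 1 : ℂ) + 1 ≠ 0 := by exact_mod_cast Nat.succ_ne_zero (2 * k + 1)
  have p1 : poch (1 - c - n) k ≠ 0 := by
    have := hc.neg.poch_ne (1 - n) k; push_cast at this; convert this using 2; ring
  have p2 : poch (c - a + n + 1) k ≠ 0 := by
    have := hca.poch_ne (n + 1) k; push_cast at this; convert this using 2; ring
  have p3 : poch (1 - b) (2 * k) ≠ 0 := by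
    have := hb.neg.poch_ne 1 (2 * k); push_cast at this; convert this using 2; ring
  have p4 : poch c k ≠ 0 := by
    have := hc.poch_ne 0 k; push_cast at this; convert this using 2; ring
  unfold gE hD tA gO
  rw [show 2 * (k + 1) = 2 * k + 1 + 1 by ring, e1, e2, poch_succ_left (c - a + n) (k + 1),
    choose_cast_succ_succ, choose_cast_succ n (2 * k + 1)]
  simp only [poch_succ (1 - a) (2 * k + 1 + 1), poch_succ (1 - a) (2 * k + 1),
    poch_succ (1 - b) (2 * k + 1), poch_succ (1 - b) (2 * k), poch_succ _ (k + 1), poch_succ _ k]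
  push_cast
  field_simp
  ring

lemma zero_step (a b c : ℂ) (hca : NonInt (c - a)) (n : ℕ) :
    hD a b c (tA a b c) n 0 = gE a b c n 0 := by
  have n3 : c - a + (n : ℂ) ≠ 0 := by
    have := hca n; push_cast at this; convert this using 1
  have n4 : c - a + ((n : ℂ) + 1) ≠ 0 := by
    have := hca (n + 1); push_cast at this; convert this using 1
  unfold hD tA gE
  simp [poch, add_assoc]
  field_simp
  ring

lemma partial_sum (a b c : ℂ) (hb : NonInt b) (hc : NonInt c) (hca : NonInt (c - a)) (n K : ℕ) :
    ∑ k ∈ Finset.range (K + 1), (hD a b c (tA a b c) n k + hD a b c (tB a b c) n k)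
      = gO a b c n K := by
  induction K with
  | zero =>
    rw [Finset.sum_range_one, zero_step a b c hca, odd_step a b c hb hc hca]
  | succ K ih =>
    rw [Finset.sum_range_succ, ih, ← add_assoc, even_step a b c hb hc hca,
      odd_step a b c hb hc hca]

lemma sumA_ext (a b c : ℂ) (n K : ℕ) (h : n ≤ K) :
    ∑ k ∈ Finset.range (n / 2 + 1), tA a b c n k = ∑ k ∈ Finset.range (K + 1), tA a b c n k := by
  symm
  apply Finset.eventually_constant_sum _ (by omega)
  intro k hk
  simp [tA, Nat.choose_eq_zero_of_lt (show n < 2 * k by omega)]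

lemma sumB_ext (a b c : ℂ) (n K : ℕ) (h : n ≤ K) :
    ∑ k ∈ Finset.range ((n + 1) / 2), tB a b c n k
      = ∑ k ∈ Finset.range (K + 1), tB a b c n k := by
  symm
  apply Finset.eventually_constant_sum _ (by omega)
  intro k hk
  simp [tB, Nat.choose_eq_zero_of_lt (show n < 2 * k + 1 by omega)]

lemma generic (a b c : ℂ) (hb : NonInt b) (hc : NonInt c) (hca : NonInt (c - a)) (n : ℕ) :
    poch (c - a) n * poch (a - b) n / (poch c n * poch (1 - b) n) =
      ∑ k ∈ Finset.range (n / 2 + 1), tA a b c n k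
      + ∑ k ∈ Finset.range ((n + 1) / 2), tB a b c n k := by
  induction n with
  | zero =>
    have : c - a ≠ 0 := by simpa using hca 0
    simp [tA, poch, this]
  | succ n ih =>
    have hs := partial_sum a b c hb hc hca n (n + 1)
    have h0 : gO a b c n (n + 1) = 0 := by
      simp [gO, Nat.choose_eq_zero_of_lt (show n < 2 * (n + 1) + 1 by omega)]
    rw [h0, Finset.sum_add_distrib] at hs
    simp only [hD, Finset.sum_sub_distrib, ← Finset.mul_sum] at hs
    rw [sumA_ext a b c n (n + 1) (by omega), sumB_ext a b c n (n + 1) (by omega)] at ih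
    rw [sumA_ext a b c (n + 1) (n + 1) le_rfl, sumB_ext a b c (n + 1) (n + 1) le_rfl]
    have n1 : c + (n : ℂ) ≠ 0 := by
      have := hc n; push_cast at this; exact this
    have n2 : 1 - b + (n : ℂ) ≠ 0 := by
      have := hb.neg (1 + n); push_cast at this; convert this using 1; ring
    have key : poch (c - a) (n + 1) * poch (a - b) (n + 1) /
        (poch c (n + 1) * poch (1 - b) (n + 1))
        = (poch (c - a) n * poch (a - b) n / (poch c n * poch (1 - b) n)) *
          ((c - a + n) * (a - b + n)) / ((c + n) * (1 - b + n)) := by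
      simp only [poch_succ]
      rw [div_mul_eq_mul_div, div_div]
      congr 1 <;> ring
    rw [key, ih, div_eq_iff (mul_ne_zero n1 n2)]
    linear_combination -hs

lemma countable_bad (u : ℂ) (s : ℂ) (hs : s ≠ 0) : {t : ℂ | ¬ NonInt (u + s * t)}.Countable := by
  refine (Set.countable_range (fun m : ℤ => (-(m : ℂ) - u) / s)).mono ?_
  intro t ht
  simp only [NonInt, Set.mem_setOf_eq, not_forall, not_not] at ht
  obtain ⟨m, hm⟩ := ht
  refine ⟨m, ?_⟩
  simp only
  rw [div_eq_iff hs]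
  linear_combination -hm

/-- Second-type reciprocal relation dual to the Pfaff–Saalschütz summation theorem,
second form. -/
theorem ps_reciprocal_second_second (n : ℕ) (a b c : ℂ)
    (hc : ∀ j : ℕ, j < n → c + (j : ℂ) ≠ 0)
    (hb : ∀ j : ℕ, j < n → 1 - b + (j : ℂ) ≠ 0)
    (hcn : ∀ j : ℕ, j ≤ n / 2 → 1 - c - (n : ℂ) + (j : ℂ) ≠ 0)
    (hca : ∀ j : ℕ, j ≤ n / 2 → c - a + (n : ℂ) + (j : ℂ) ≠ 0) :
    poch (c - a) n * poch (a - b) n / (poch c n * poch (1 - b) n) =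
      (∑ k ∈ Finset.range (n / 2 + 1),
        (n.choose (2 * k) : ℂ) *
          ((c - a + 3 * (k : ℂ)) * poch (1 - a) (2 * k) * poch (a - b - c + 1) k *
            poch (b + c - a) k * poch (c - a) k) /
          (poch (1 - c - (n : ℂ)) k * poch (c - a + (n : ℂ)) (k + 1) *
            poch (1 - b) (2 * k) * poch c k)) +
      ∑ k ∈ Finset.range ((n + 1) / 2),
        (n.choose (2 * k + 1) : ℂ) *
          ((c + (k : ℂ)) * poch (1 - a) (2 * k + 1) * poch (a - b - c + 1) k *
            poch (b + c - a) (k + 1) * poch (c - a) (k + 1)) /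
          (poch (1 - c - (n : ℂ)) (k + 1) * poch (c - a + (n : ℂ)) (k + 1) *
            poch (1 - b) (2 * k + 1) * poch c (k + 1)) := by
  have key : ∃ᶠ t in nhds (0 : ℂ), poch ((c + t) - (a + 2 * t)) n * poch ((a + 2 * t) - (b + t)) n /
        (poch (c + t) n * poch (1 - (b + t)) n) -
      (∑ k ∈ Finset.range (n / 2 + 1), tA (a + 2 * t) (b + t) (c + t) n k
      + ∑ k ∈ Finset.range ((n + 1) / 2), tB (a + 2 * t) (b + t) (c + t) n k) ∈ ({0} : Set ℂ) := by
    have hd := (((countable_bad b 1 one_ne_zero).union (countable_bad c 1 one_ne_zero)).union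
      (countable_bad (c - a) (-1) (by norm_num))).dense_compl ℂ
    refine (mem_closure_iff_frequently.1 (hd 0)).mono ?_
    intro t ht
    simp only [Set.mem_compl_iff, Set.mem_union, Set.mem_setOf_eq, not_or, not_not, one_mul] at ht
    obtain ⟨⟨h1, h2⟩, h3⟩ := ht
    rw [Set.mem_singleton_iff, sub_eq_zero]
    apply generic _ _ _ h1 h2
    convert h3 using 1
    ring
  have cont : ContinuousAt (fun t : ℂ => poch ((c + t) - (a + 2 * t)) n *
        poch ((a + 2 * t) - (b + t)) n / (poch (c + t) n * poch (1 - (b + t)) n) -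
      (∑ k ∈ Finset.range (n / 2 + 1), tA (a + 2 * t) (b + t) (c + t) n k
      + ∑ k ∈ Finset.range ((n + 1) / 2), tB (a + 2 * t) (b + t) (c + t) n k)) 0 := by
    have cp : ∀ (m : ℕ) (f : ℂ → ℂ), Continuous f → Continuous fun t => poch (f t) m :=
      fun m f hf => (continuous_poch m).comp hf
    refine ContinuousAt.sub (ContinuousAt.div ?_ ?_ ?_) (ContinuousAt.add ?_ ?_)
    · refine Continuous.continuousAt (Continuous.mul (cp _ _ ?_) (cp _ _ ?_)) <;> fun_prop
    · refine Continuous.continuousAt (Continuous.mul (cp _ _ ?_) (cp _ _ ?_)) <;> fun_prop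
    · simp only [add_zero]
      exact mul_ne_zero (poch_ne_zero _ _ hc) (poch_ne_zero _ _ hb)
    · refine tendsto_finset_sum _ fun k hk => ?_
      have hk' := Finset.mem_range.1 hk
      unfold tA
      refine ContinuousAt.div (Continuous.continuousAt ?_) (Continuous.continuousAt ?_) ?_
      · have := cp (2 * k) (fun t => 1 - (a + 2 * t)) (by fun_prop)
        have := cp k (fun t => (a + 2 * t) - (b + t) - (c + t) + 1) (by fun_prop)
        have := cp k (fun t => (b + t) + (c + t) - (a + 2 * t)) (by fun_prop)
        have := cp k (fun t => (c + t) - (a + 2 * t)) (by fun_prop)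
        fun_prop
      · have := cp k (fun t => 1 - (c + t) - n) (by fun_prop)
        have := cp (k + 1) (fun t => (c + t) - (a + 2 * t) + n) (by fun_prop)
        have := cp (2 * k) (fun t => 1 - (b + t)) (by fun_prop)
        have := cp k (fun t => (c + t)) (by fun_prop)
        fun_prop
      · simp only [add_zero, mul_zero]
        refine mul_ne_zero (mul_ne_zero (mul_ne_zero ?_ ?_) ?_) ?_ <;> apply poch_ne_zero <;>
          intro j hj
        · exact hcn j (by omega)
        · exact hca j (by omega)
        · exact hb j (by omega)
        · exact hc j (by omega)
    · refine tendsto_finset_sum _ fun k hk => ?_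
      have hk' := Finset.mem_range.1 hk
      unfold tB
      refine ContinuousAt.div (Continuous.continuousAt ?_) (Continuous.continuousAt ?_) ?_
      · have := cp (2 * k + 1) (fun t => 1 - (a + 2 * t)) (by fun_prop)
        have := cp k (fun t => (a + 2 * t) - (b + t) - (c + t) + 1) (by fun_prop)
        have := cp (k + 1) (fun t => (b + t) + (c + t) - (a + 2 * t)) (by fun_prop)
        have := cp (k + 1) (fun t => (c + t) - (a + 2 * t)) (by fun_prop)
        fun_prop
      · have := cp (k + 1) (fun t => 1 - (c + t) - n) (by fun_prop)
        have := cp (k + 1) (fun t => (c + t) - (a + 2 * t) + n) (by fun_prop)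
        have := cp (2 * k + 1) (fun t => 1 - (b + t)) (by fun_prop)
        have := cp (k + 1) (fun t => (c + t)) (by fun_prop)
        fun_prop
      · simp only [add_zero, mul_zero]
        refine mul_ne_zero (mul_ne_zero (mul_ne_zero ?_ ?_) ?_) ?_ <;> apply poch_ne_zero <;>
          intro j hj
        · exact hcn j (by omega)
        · exact hca j (by omega)
        · exact hb j (by omega)
        · exact hc j (by omega)
  have fin := isClosed_singleton.mem_of_frequently_of_tendsto key cont
  simp only [add_zero, mul_zero, Set.mem_singleton_iff, sub_eq_zero] at fin
  exact fin
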